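/- arXiv:math/0511419 — 2 statements merged into one kernel-verified Lean document; each statement's English description precedes it below -/
import Mathlib

section
/- For n ≥ 1, the number of permutations w of {1,...,n} with as(w) ≤ 3 equals (3^n - 2n + 3)/4. -/
/-- The list of values of a permutation of `Fin n` (0-indexed; relative order
is what matters). -/
def permList (n : ℕ) (w : Equiv.Perm (Fin n)) : List ℕ :=
  List.ofFn (fun i => (w i : ℕ))

/-- A list is alternating: `a > b < c > d < ⋯` (descents in even positions). -/
def IsAlt (l : List ℕ) : Prop :=
  ∀ i : ℕ, ∀ hi : i + 1 < l.length,
    if i % 2 = 0 then l.get ⟨i + 1, hi⟩ < l.get ⟨i, Nat.lt_of_succ_lt hi⟩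
    else l.get ⟨i, Nat.lt_of_succ_lt hi⟩ < l.get ⟨i + 1, hi⟩

/-- `asLen n w` : the maximum length of an alternating subsequence of `w`. -/
noncomputable def asLen (n : ℕ) (w : Equiv.Perm (Fin n)) : ℕ :=
  sSup {k | ∃ l : List ℕ, l.Sublist (permList n w) ∧ IsAlt l ∧ l.length = k}

/-- `aCount n k = #{w ∈ S_n : as(w) = k}`. -/
noncomputable def aCount (n k : ℕ) : ℕ :=
  Nat.card {w : Equiv.Perm (Fin n) // asLen n w = k}

/-- `bCount n k = #{w ∈ S_n : as(w) ≤ k}`. -/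
noncomputable def bCount (n k : ℕ) : ℕ :=
  Nat.card {w : Equiv.Perm (Fin n) // asLen n w ≤ k}

/-- The values of `w` at some four increasing positions form an alternating sequence. -/
def HasAltFour {n : ℕ} (w : Equiv.Perm (Fin n)) : Prop :=
  ∃ i j k l : Fin n, i < j ∧ j < k ∧ k < l ∧ w j < w i ∧ w j < w k ∧ w l < w k

theorem asLen_le_three_iff {n : ℕ} (w : Equiv.Perm (Fin n)) :
    asLen n w ≤ 3 ↔ ¬ HasAltFour w := by
  have hbdd : BddAbove {k | ∃ l : List ℕ, l.Sublist (permList n w) ∧ IsAlt l ∧ l.length = k} := by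
    refine ⟨(permList n w).length, ?_⟩
    rintro k ⟨l, hl, -, rfl⟩
    exact hl.length_le
  constructor
  · rintro h ⟨i, j, k, l, hij, hjk, hkl, h1, h2, h3⟩
    have hsub : List.Sublist [(w i : ℕ), w j, w k, w l] (permList n w) := by
      have := List.Sublist.map (fun x => (w x : ℕ)) (List.map_getElem_sublist (l := List.finRange n)
        (is := [i.cast (by simp), j.cast (by simp), k.cast (by simp), l.cast (by simp)])
        (by simp [List.pairwise_cons]; omega))
      simpa [permList, List.ofFn_eq_map] using this
    have halt : IsAlt [(w i : ℕ), w j, w k, w l] := by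
      intro a ha
      simp only [List.length_cons, List.length_nil] at ha
      have ha' : a < 3 := by omega
      interval_cases a <;> simpa
    have : 4 ≤ asLen n w := le_csSup hbdd ⟨_, hsub, halt, rfl⟩
    omega
  · intro h
    refine csSup_le ⟨0, [], by simp, fun i hi => by simp at hi, rfl⟩ ?_
    rintro _ ⟨l, hl, halt, rfl⟩
    by_contra! hlen
    obtain ⟨f, hf⟩ := List.sublist_iff_exists_fin_orderEmbedding_get_eq.1 hl
    have hn : (permList n w).length = n := by simp [permList]
    have hget : ∀ a : Fin l.length, l.get a = (w ((f a).cast hn) : ℕ) := by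
      intro a
      rw [hf a]
      simp [permList]
      rfl
    have h0 := halt 0 (by omega)
    have h1 := halt 1 (by omega)
    have h2 := halt 2 (by omega)
    simp only [hget] at h0 h1 h2
    refine h ⟨(f ⟨0, by omega⟩).cast hn, (f ⟨1, by omega⟩).cast hn, (f ⟨2, by omega⟩).cast hn,
      (f ⟨3, by omega⟩).cast hn, ?_, ?_, ?_, ?_, ?_, ?_⟩
    · simp
    · simp
    · simp
    · simpa using h0
    · simpa using h1
    · simpa using h2

/-- Without an alternating subsequence of length four, the descents are contiguous. -/
theorem descents_eq_interval {m : ℕ} {w : Equiv.Perm (Fin (m + 1))} (h : ¬ HasAltFour w)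
    (hd : ∃ i : Fin m, w i.succ < w i.castSucc) :
    ∃ p q : Fin m, p ≤ q ∧ ∀ i : Fin m, w i.succ < w i.castSucc ↔ p ≤ i ∧ i ≤ q := by
  classical
  obtain ⟨p, hp, hpmin⟩ := WellFounded.has_min wellFounded_lt
    {i : Fin m | w i.succ < w i.castSucc} hd
  obtain ⟨q, hq, hqmax⟩ := WellFounded.has_min wellFounded_gt
    {i : Fin m | w i.succ < w i.castSucc} hd
  refine ⟨p, q, not_lt.1 (hpmin q hq), fun i =>
    ⟨fun hi => ⟨not_lt.1 (hpmin i hi), not_lt.1 (hqmax i hi)⟩, fun ⟨hpi, hiq⟩ => ?_⟩⟩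
  by_contra hi
  obtain ⟨b, ⟨hb, hbi⟩, hbmax⟩ := WellFounded.has_min wellFounded_gt
    {j : Fin m | w j.succ < w j.castSucc ∧ j < i}
    ⟨p, hp, lt_of_le_of_ne hpi (by rintro rfl; exact hi hp)⟩
  obtain ⟨c, ⟨hc, hic⟩, hcmin⟩ := WellFounded.has_min wellFounded_lt
    {j : Fin m | w j.succ < w j.castSucc ∧ i < j}
    ⟨q, hq, lt_of_le_of_ne hiq (by rintro rfl; exact hi hq)⟩
  have asc : ∀ j : Fin m, b < j → j < c → ¬ w j.succ < w j.castSucc := by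
    intro j hbj hjc hj
    rcases lt_trichotomy j i with hji | rfl | hij
    · exact hbmax j ⟨hj, hji⟩ hbj
    · exact hi hj
    · exact hcmin j ⟨hj, hij⟩ hjc
  have chain : ∀ k : ℕ, (b : ℕ) + 1 ≤ k → ∀ hk : k < m + 1, k ≤ c → w b.succ ≤ w ⟨k, hk⟩ := by
    intro k hbk
    induction k, hbk using Nat.le_induction with
    | base => exact fun _ _ => le_rfl
    | succ k hbk ih =>
      intro hk hkc
      refine (ih (by omega) (by omega)).trans ?_
      exact not_lt.1 (asc ⟨k, by omega⟩ (Fin.lt_def.2 (by simp only; omega))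
        (Fin.lt_def.2 (by simp only; omega)))
  have hbc : b.succ < c.castSucc := by
    rw [Fin.lt_def, Fin.val_succ, Fin.val_castSucc]
    omega
  refine h ⟨b.castSucc, b.succ, c.castSucc, c.succ, Fin.castSucc_lt_succ, hbc,
    Fin.castSucc_lt_succ, hb, lt_of_le_of_ne ?_ ?_, hc⟩
  · exact chain c (by omega) (by omega) le_rfl
  · exact fun e => hbc.ne (w.injective e)

/-- Sorting by this key lists the values of colour `0` increasingly, then those of colour `1`
decreasingly, then those of colour `2` increasingly. -/
def blockKey {n : ℕ} (c : Fin 3) (v : Fin n) : Fin 3 ×ₗ ℤ :=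
  toLex (c, if c = 1 then -(v : ℤ) else v)

theorem blockKey_lt_iff {n : ℕ} {c d : Fin 3} {u v : Fin n} :
    blockKey c u < blockKey d v ↔ c < d ∨ c = d ∧ if c = 1 then v < u else u < v := by
  rw [blockKey, blockKey, Prod.Lex.toLex_lt_toLex]
  refine or_congr Iff.rfl (and_congr_right ?_)
  rintro (rfl : c = d)
  split_ifs <;> simp

theorem blockKey_injective {n : ℕ} (f : Fin n → Fin 3) :
    Function.Injective fun v => blockKey (f v) v := by
  intro u v h
  simp only [blockKey, EmbeddingLike.apply_eq_iff_eq, Prod.mk.injEq] at h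
  obtain ⟨h1, h2⟩ := h
  rw [h1] at h2
  split_ifs at h2 <;> omega

/-- Each colouring of the values is compatible with exactly one permutation. -/
theorem strictMono_blockKey_comp_iff {n : ℕ} (f : Fin n → Fin 3) (w : Equiv.Perm (Fin n)) :
    StrictMono (fun i => blockKey (f (w i)) (w i)) ↔ w = Tuple.sort fun v => blockKey (f v) v := by
  rw [Tuple.eq_sort_iff]
  constructor
  · exact fun h => ⟨h.monotone, fun i j hij e => absurd e (h hij).ne⟩
  · rintro ⟨h, -⟩
    exact h.strictMono_of_injective ((blockKey_injective f).comp w.injective)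

open Classical in
/-- The colourings of the positions into consecutive blocks `0`, `1`, `2` on which `w` is
respectively increasing, decreasing and increasing. -/
noncomputable def blockColorings {n : ℕ} (w : Equiv.Perm (Fin n)) : Finset (Fin n → Fin 3) :=
  {g | StrictMono fun i => blockKey (g i) (w i)}

theorem sum_card_blockColorings (n : ℕ) :
    ∑ w : Equiv.Perm (Fin n), (blockColorings w).card = 3 ^ n := by
  classical
  have hcomp (w : Equiv.Perm (Fin n)) : (blockColorings w).card =
      (Finset.univ.filter fun f : Fin n → Fin 3 =>
        w = Tuple.sort fun v => blockKey (f v) v).card := by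
    refine Finset.card_equiv (Equiv.arrowCongr w (Equiv.refl _)) fun g => ?_
    simp [blockColorings, ← strictMono_blockKey_comp_iff]
  simp_rw [hcomp]
  simp_rw [eq_comm (b := Tuple.sort _)]
  rw [← Finset.card_eq_sum_card_fiberwise (s := Finset.univ) (t := Finset.univ) (by simp)]
  simp

theorem not_hasAltFour_of_mem_blockColorings {n : ℕ} {w : Equiv.Perm (Fin n)} {g : Fin n → Fin 3}
    (hg : g ∈ blockColorings w) : ¬ HasAltFour w := by
  rintro ⟨i, j, k, l, hij, hjk, hkl, h1, h2, h3⟩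
  simp only [blockColorings, Finset.mem_filter, Finset.mem_univ, true_and] at hg
  have a := blockKey_lt_iff.1 (hg hij)
  have b := blockKey_lt_iff.1 (hg hjk)
  have c := blockKey_lt_iff.1 (hg hkl)
  generalize g i = x at *
  generalize g j = y at *
  generalize g k = z at *
  generalize g l = t at *
  split_ifs at a b c <;> omega

/-- The colouring of `Fin n` with blocks `[0, s)`, `[s, t)`, `[t, n)`. -/
def cutColoring (n s t : ℕ) (i : Fin n) : Fin 3 :=
  if (i : ℕ) < s then 0 else if (i : ℕ) < t then 1 else 2

theorem exists_forall_iff_lt {n : ℕ} {P : Fin n → Prop} (hP : ∀ i j, i ≤ j → P j → P i) :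
    ∃ s ≤ n, ∀ i : Fin n, P i ↔ (i : ℕ) < s := by
  classical
  have hex : ∃ s, ∀ i : Fin n, P i → (i : ℕ) < s := ⟨n, fun i _ => i.2⟩
  refine ⟨Nat.find hex, Nat.find_min' hex fun i _ => i.2, fun i =>
    ⟨Nat.find_spec hex i, fun hi => ?_⟩⟩
  have := Nat.find_min hex hi
  push Not at this
  obtain ⟨j, hj, hij⟩ := this
  exact hP i j hij hj

theorem exists_cutColoring_eq {n : ℕ} {g : Fin n → Fin 3} (hg : Monotone g) :
    ∃ s t, s ≤ t ∧ t ≤ n ∧ cutColoring n s t = g := by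
  obtain ⟨s, hs, hs'⟩ := exists_forall_iff_lt (P := fun i => g i ≤ 0)
    fun i j hij hj => (hg hij).trans hj
  obtain ⟨t, ht, ht'⟩ := exists_forall_iff_lt (P := fun i => g i ≤ 1)
    fun i j hij hj => (hg hij).trans hj
  refine ⟨s, t, ?_, ht, ?_⟩
  · by_contra! hts
    have h1 := (hs' ⟨t, by omega⟩).2 hts
    have h2 := (ht' ⟨t, by omega⟩).not.2 (lt_irrefl _)
    exact h2 (h1.trans (by decide))
  · funext i
    rw [cutColoring]
    have h1 := hs' i
    have h2 := ht' i
    split_ifs <;> omega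

theorem cutColoring_inj {n s t s' t' : ℕ} (hst : s ≤ t) (ht : t ≤ n) (hst' : s' ≤ t')
    (ht' : t' ≤ n) (h : cutColoring n s t = cutColoring n s' t') : s = s' ∧ t = t' := by
  have key (a : ℕ) (ha : a < n) : (a < s ↔ a < s') ∧ (a < t ↔ a < t') := by
    have := congrFun h ⟨a, ha⟩
    simp only [cutColoring] at this
    split_ifs at this <;> omega
  constructor
  · rcases lt_trichotomy s s' with hs | hs | hs
    · have := key s (by omega); omega
    · exact hs
    · have := key s' (by omega); omega
  · rcases lt_trichotomy t t' with hs | hs | hs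
    · have := key t (by omega); omega
    · exact hs
    · have := key t' (by omega); omega

theorem cutColoring_mem_blockColorings_iff {m s t : ℕ} (hst : s ≤ t)
    (w : Equiv.Perm (Fin (m + 1))) :
    cutColoring (m + 1) s t ∈ blockColorings w ↔ ∀ i : Fin m,
      (w i.succ < w i.castSucc → s ≤ i + 1 ∧ i + 1 ≤ t) ∧
      (¬ w i.succ < w i.castSucc → i < s ∨ t ≤ i + 1) := by
  simp only [blockColorings, Finset.mem_filter, Finset.mem_univ, true_and,
    Fin.strictMono_iff_lt_succ, blockKey_lt_iff]
  refine forall_congr' fun i => ?_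
  have hne : w i.castSucc ≠ w i.succ := fun e => (Fin.castSucc_lt_succ).ne (w.injective e)
  simp only [cutColoring, Fin.val_succ, Fin.val_castSucc]
  by_cases hd : w i.succ < w i.castSucc
  · have hd' := hd.not_gt
    simp only [hd, hd']
    split_ifs <;> simp <;> omega
  · have hd' := lt_of_le_of_ne (not_lt.1 hd) hne
    simp only [hd, hd']
    split_ifs <;> simp <;> omega

/-- Block colourings correspond to pairs of cut points. -/
theorem card_blockColorings {n : ℕ} (w : Equiv.Perm (Fin n)) (S : Finset (ℕ × ℕ))
    (hS : ∀ x : ℕ × ℕ, x ∈ S ↔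
      x.1 ≤ x.2 ∧ x.2 ≤ n ∧ cutColoring n x.1 x.2 ∈ blockColorings w) :
    (blockColorings w).card = S.card := by
  symm
  refine Finset.card_bij (fun x _ => cutColoring n x.1 x.2) (fun x hx => ((hS x).1 hx).2.2) ?_ ?_
  · intro x hx y hy h
    obtain ⟨hx1, hx2, -⟩ := (hS x).1 hx
    obtain ⟨hy1, hy2, -⟩ := (hS y).1 hy
    exact Prod.ext_iff.2 (cutColoring_inj hx1 hx2 hy1 hy2 h)
  · intro g hg
    have hmono : Monotone g := by
      simp only [blockColorings, Finset.mem_filter, Finset.mem_univ, true_and] at hg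
      refine monotone_iff_forall_lt.2 fun i j hij => ?_
      rcases blockKey_lt_iff.1 (hg hij) with h | h
      · exact h.le
      · exact h.1.le
    obtain ⟨s, t, hst, ht, rfl⟩ := exists_cutColoring_eq hmono
    exact ⟨(s, t), (hS _).2 ⟨hst, ht, hg⟩, rfl⟩

theorem card_blockColorings_one (m : ℕ) :
    (blockColorings (1 : Equiv.Perm (Fin (m + 1)))).card = 2 * (m + 1) + 1 := by
  rw [card_blockColorings 1 ((Finset.range (m + 2)).image (fun s => (s, s)) ∪
    (Finset.range (m + 1)).image (fun s => (s, s + 1)))]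
  · rw [Finset.card_union_of_disjoint, Finset.card_image_of_injective,
      Finset.card_image_of_injective, Finset.card_range, Finset.card_range]
    · omega
    · exact fun a b h => (Prod.ext_iff.1 h).1
    · exact fun a b h => (Prod.ext_iff.1 h).1
    · rw [Finset.disjoint_left]
      simp only [Finset.mem_image, not_exists, not_and]
      rintro _ ⟨a, -, rfl⟩ b - h
      simp only [Prod.mk.injEq] at h
      omega
  · rintro ⟨s, t⟩
    simp only [Finset.mem_union, Finset.mem_image, Finset.mem_range, Prod.mk.injEq]
    constructor
    · intro h
      have hst : s ≤ t ∧ t ≤ m + 1 ∧ t ≤ s + 1 := by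
        rcases h with ⟨a, _, _, _⟩ | ⟨a, _, _, _⟩ <;> omega
      refine ⟨hst.1, hst.2.1, (cutColoring_mem_blockColorings_iff hst.1 _).2 fun i => ?_⟩
      have : ¬ i.succ < i.castSucc := by simp [Fin.lt_def]
      simp only [Equiv.Perm.one_apply]
      exact ⟨fun h => absurd h this, fun _ => by omega⟩
    · rintro ⟨hst, ht, h⟩
      rw [cutColoring_mem_blockColorings_iff hst] at h
      have hts : t ≤ s + 1 := by
        by_contra! hlt
        have := (h ⟨s, by omega⟩).2 (by simp [Fin.lt_def])
        simp only at this
        omega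
      rcases (show t = s ∨ t = s + 1 by omega) with rfl | rfl
      · exact Or.inl ⟨t, by omega, rfl, rfl⟩
      · exact Or.inr ⟨s, by omega, rfl, rfl⟩

theorem exists_descent {m : ℕ} {w : Equiv.Perm (Fin (m + 1))} (hw : w ≠ 1) :
    ∃ i : Fin m, w i.succ < w i.castSucc := by
  by_contra! h
  have hmono : StrictMono w := Fin.strictMono_iff_lt_succ.2 fun i =>
    lt_of_le_of_ne (h i) fun e => (Fin.castSucc_lt_succ).ne (w.injective e)
  refine hw (Equiv.ext fun i => ?_)
  exact congrFun ((hmono.range_inj strictMono_id).1 (by simp [w.surjective.range_eq])) i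

theorem card_blockColorings_of_ne_one {m : ℕ} {w : Equiv.Perm (Fin (m + 1))} (hw : w ≠ 1)
    (h : ¬ HasAltFour w) : (blockColorings w).card = 4 := by
  obtain ⟨p, q, hpq, hD⟩ := descents_eq_interval h (exists_descent hw)
  rw [card_blockColorings w (({(p : ℕ), (p : ℕ) + 1} : Finset ℕ) ×ˢ
    ({(q : ℕ) + 1, (q : ℕ) + 2} : Finset ℕ))]
  · rw [Finset.card_product, Finset.card_pair (by omega), Finset.card_pair (by omega)]
  · rintro ⟨s, t⟩
    have hpq' : (p : ℕ) ≤ q := hpq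
    have hqm := q.2
    simp only [Finset.mem_product, Finset.mem_insert, Finset.mem_singleton]
    constructor
    · intro hst
      refine ⟨by omega, by omega, (cutColoring_mem_blockColorings_iff (by omega) _).2 fun i => ?_⟩
      rw [hD i, Fin.le_def, Fin.le_def]
      omega
    · rintro ⟨hst, ht, hmem⟩
      rw [cutColoring_mem_blockColorings_iff hst] at hmem
      simp only [hD, Fin.le_def] at hmem
      have h1 := hmem p
      have h2 := hmem q
      constructor
      · by_contra! hs
        have := hmem ⟨s, by omega⟩
        simp only at this
        omega
      · by_contra! hs
        have := hmem ⟨t - 2, by omega⟩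
        simp only at this
        omega

theorem bCount_three (n : ℕ) (hn : 1 ≤ n) :
    (4 * bCount n 3 : ℤ) = 3 ^ n - 2 * n + 3 := by
  classical
  obtain ⟨m, rfl⟩ : ∃ m, n = m + 1 := ⟨n - 1, by omega⟩
  set A : Finset (Equiv.Perm (Fin (m + 1))) := {w | ¬ HasAltFour w} with hA
  have hb : bCount (m + 1) 3 = A.card := by
    simp only [bCount, asLen_le_three_iff, Nat.card_eq_fintype_card, Fintype.card_subtype, hA]
  have h1 : 1 ∈ A := by
    have hne : (blockColorings (1 : Equiv.Perm (Fin (m + 1)))).Nonempty := by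
      rw [← Finset.card_pos, card_blockColorings_one]
      omega
    obtain ⟨g, hg⟩ := hne
    simpa [hA] using not_hasAltFour_of_mem_blockColorings hg
  have hsum := sum_card_blockColorings (m + 1)
  rw [← Finset.sum_subset (Finset.subset_univ A), ← Finset.add_sum_erase A _ h1,
    card_blockColorings_one, Finset.sum_congr rfl (g := fun _ => 4), Finset.sum_const,
    Finset.card_erase_of_mem h1] at hsum
  · have hpos : 0 < A.card := Finset.card_pos.2 ⟨1, h1⟩
    rw [hb]
    zify at hsum
    rw [← hsum]
    simp only [smul_eq_mul]
    push_cast [Nat.cast_sub hpos]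
    ring
  · intro w hw
    rw [Finset.mem_erase] at hw
    exact card_blockColorings_of_ne_one hw.1 (by simpa [hA] using hw.2)
  · intro w _ hw
    rw [Finset.card_eq_zero, Finset.eq_empty_iff_forall_notMem]
    exact fun g hg => hw (by simpa [hA] using not_hasAltFour_of_mem_blockColorings hg)
end

section
/- For n ≥ 1, the number of permutations w of {1,...,n} with as(w) ≤ 4 equals (4^n - 2(n-2)·2^n)/8. -/
/-- The number of changes of direction met when reading `l` after the letter `a`, where `d` records
whether the last step (into `a`) went up. -/
def turns : Bool → ℕ → List ℕ → ℕ
  | _, _, [] => 0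
  | true, a, b :: l => if b < a then turns false b l + 1 else turns true b l
  | false, a, b :: l => if b < a then turns false b l else turns true b l + 1

/-- A list is alternating, with first step a descent if `d` and an ascent otherwise. -/
def AltFrom : Bool → List ℕ → Prop
  | _, [] => True
  | _, [_] => True
  | true, a :: b :: l => b < a ∧ AltFrom false (b :: l)
  | false, a :: b :: l => a < b ∧ AltFrom true (b :: l)

lemma altFrom_iff (l : List ℕ) (d : Bool) :
    AltFrom d l ↔ ∀ i : ℕ, ∀ hi : i + 1 < l.length,
      if i % 2 = (if d then 0 else 1) then l[i + 1] < l[i] else l[i] < l[i + 1] := by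
  induction l generalizing d with
  | nil => simp [AltFrom]
  | cons a l ih =>
    cases l with
    | nil => simp [AltFrom]
    | cons b l =>
      have key : ∀ i, (i + 1) % 2 = 0 ↔ i % 2 = 1 := by omega
      have key' : ∀ i, (i + 1) % 2 = 1 ↔ i % 2 = 0 := by omega
      cases d
      · rw [AltFrom, ih]
        constructor
        · rintro ⟨h0, h⟩ (_ | i) hi
          · simpa using h0
          · have := h i (by simpa using hi)
            simpa [key'] using this
        · intro h
          refine ⟨by simpa using h 0 (by simp), fun i hi => ?_⟩
          have := h (i + 1) (by simpa using hi)
          simpa [key'] using this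
      · rw [AltFrom, ih]
        constructor
        · rintro ⟨h0, h⟩ (_ | i) hi
          · simpa using h0
          · have := h i (by simpa using hi)
            simpa [key] using this
        · intro h
          refine ⟨by simpa using h 0 (by simp), fun i hi => ?_⟩
          have := h (i + 1) (by simpa using hi)
          simpa [key] using this

lemma isAlt_iff_altFrom (l : List ℕ) : IsAlt l ↔ AltFrom true l := by
  simp [altFrom_iff, IsAlt]

lemma AltFrom.tail {d : Bool} {a : ℕ} {l : List ℕ} (h : AltFrom d (a :: l)) : AltFrom (!d) l := by
  cases l <;> cases d <;> simp_all [AltFrom]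

lemma AltFrom.replace_head_true {a b : ℕ} {l : List ℕ} (h : AltFrom true (a :: l)) (hab : a ≤ b) :
    AltFrom true (b :: l) := by
  cases l with
  | nil => simp [AltFrom]
  | cons c l => exact ⟨h.1.trans_le hab, h.2⟩

lemma AltFrom.replace_head_false {a b : ℕ} {l : List ℕ} (h : AltFrom false (a :: l)) (hab : b ≤ a) :
    AltFrom false (b :: l) := by
  cases l with
  | nil => simp [AltFrom]
  | cons c l => exact ⟨hab.trans_lt h.1, h.2⟩

lemma AltFrom.length_le {d : Bool} {a : ℕ} {l s : List ℕ} (hs : s.Sublist (a :: l))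
    (h : AltFrom d s) : s.length ≤ turns d a l + 1 := by
  induction l generalizing d a s with
  | nil => simpa [turns] using hs.length_le
  | cons b l ih =>
    rcases List.sublist_cons_iff.1 hs with hs | ⟨t, rfl, ht⟩
    · have h1 := ih hs h
      have h2 : s.length ≤ turns (!d) b l + 1 + 1 := by
        cases s with
        | nil => simp
        | cons c s => simpa using ih ((List.sublist_cons_self c s).trans hs) h.tail
      cases d <;> simp only [turns, Bool.not_true, Bool.not_false] at * <;> split_ifs <;> omega
    · have h2 := ih ht h.tail
      have h1 : (d = true ↔ ¬ b < a) → (a :: t).length ≤ turns d b l + 1 := by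
        intro hd
        rcases List.sublist_cons_iff.1 ht with ht | ⟨t, rfl, ht⟩
        · have hb : AltFrom d (b :: t) := by
            cases d
            · exact h.replace_head_false (by simp at hd; omega)
            · exact h.replace_head_true (by simp at hd; omega)
          simpa using ih (ht.cons_cons b) hb
        · cases d
          · have := h.1
            simp at hd; omega
          · have := h.1
            simp at hd; omega
      cases d <;> simp only [turns, Bool.not_true, Bool.not_false, List.length_cons] at * <;>
        split_ifs <;> simp_all

lemma exists_altFrom_length_eq (d : Bool) {a : ℕ} {l : List ℕ} (hl : (a :: l).Nodup) :
    ∃ c t, (c :: t).Sublist (a :: l) ∧ AltFrom d (c :: t) ∧ t.length = turns d a l ∧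
      (if d then a ≤ c else c ≤ a) := by
  induction l generalizing d a with
  | nil => exact ⟨a, [], by simp, by cases d <;> simp [AltFrom], by simp [turns], by simp⟩
  | cons b l ih =>
    have hab : a ≠ b := by simp_all
    have hl' := (List.nodup_cons.1 hl).2
    by_cases hba : b < a
    · obtain ⟨c, t, hs, h, hlen, hc⟩ := ih false hl'
      simp only [Bool.false_eq_true, if_false] at hc
      cases d
      · exact ⟨c, t, hs.cons a, h, by simp [turns, hba, hlen], by simp; omega⟩
      · exact ⟨a, c :: t, hs.cons_cons a, ⟨by omega, h⟩, by simp [turns, hba, hlen], by simp⟩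
    · obtain ⟨c, t, hs, h, hlen, hc⟩ := ih true hl'
      simp only [if_true] at hc
      cases d
      · exact ⟨a, c :: t, hs.cons_cons a, ⟨by omega, h⟩, by simp [turns, hba, hlen], by simp⟩
      · exact ⟨c, t, hs.cons a, h, by simp [turns, hba, hlen], by simp; omega⟩

lemma isGreatest_turns {l : List ℕ} (hl : l.Nodup) :
    IsGreatest {k | ∃ s : List ℕ, s.Sublist l ∧ IsAlt s ∧ s.length = k} (turns false 0 l) := by
  simp only [isAlt_iff_altFrom]
  cases l with
  | nil => exact ⟨⟨[], by simp [AltFrom, turns]⟩, by rintro k ⟨s, hs, -, rfl⟩; simp_all⟩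
  | cons a l =>
    constructor
    · obtain ⟨c, t, hs, h, hlen, -⟩ := exists_altFrom_length_eq true hl
      exact ⟨c :: t, hs, h, by simp [turns, hlen]⟩
    · rintro k ⟨s, hs, h, rfl⟩
      simpa [turns] using h.length_le hs

lemma nodup_permList (n : ℕ) (w : Equiv.Perm (Fin n)) : (permList n w).Nodup :=
  List.nodup_ofFn.2 (Fin.val_injective.comp w.injective)

lemma asLen_eq_turns (n : ℕ) (w : Equiv.Perm (Fin n)) :
    asLen n w = turns false 0 (permList n w) :=
  (isGreatest_turns (nodup_permList n w)).csSup_eq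

lemma sum_turns_insert (f : ℕ → ℤ) {m a : ℕ} {l : List ℕ} (hl : ∀ b ∈ l, b < m) (ha : a ≤ m) :
    ((l.permutations'Aux m).map fun s => f (turns false a s)).sum =
        turns false a l * f (turns false a l) + f (turns false a l + 1) +
          (l.length - turns false a l) * f (turns false a l + 2) ∧
      ((l.permutations'Aux m).map fun s => f (turns true a s)).sum + f (turns false a l + 1) =
        (turns true a l + 1) * f (turns true a l) + f (turns true a l + 1) +
          (l.length - turns true a l) * f (turns true a l + 2) := by
  induction l generalizing a f with
  | nil => simp [turns, ha.not_gt]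
  | cons b l ih =>
    have hb : b < m := hl b (by simp)
    have hl' : ∀ c ∈ l, c < m := fun c hc => hl c (by simp [hc])
    have h0 := ih f hl' hb.le
    have h1 := ih (fun k => f (k + 1)) hl' hb.le
    by_cases hba : b < a
    · constructor
      · simp [turns, hba, hb, ha.not_gt, Function.comp_def, h0.1]
        ring
      · simp [turns, hba, hb, ha.not_gt, Function.comp_def, h1.1]
        ring_nf
    · have h0' := h0.2
      have h1' := eq_sub_of_add_eq h1.2
      constructor
      · simp [turns, hba, hb, ha.not_gt, Function.comp_def, h1']
      · simp [turns, hba, hb, ha.not_gt, Function.comp_def, eq_sub_of_add_eq h0']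
        ring_nf

/-- The arrangements of `0, …, n - 1`. -/
def arrangements (n : ℕ) : List (List ℕ) := (List.range n).reverse.permutations'

lemma arrangements_succ (n : ℕ) :
    arrangements (n + 1) = (arrangements n).flatMap (List.permutations'Aux n) := by
  simp [arrangements, List.range_succ, List.permutations']

lemma mem_arrangements {n : ℕ} {l : List ℕ} : l ∈ arrangements n ↔ l.Perm (List.range n) := by
  rw [arrangements, List.mem_permutations']
  exact ⟨fun h => h.trans (List.reverse_perm _), fun h => h.trans (List.reverse_perm _).symm⟩

lemma nodup_arrangements (n : ℕ) : (arrangements n).Nodup :=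
  (List.permutations_perm_permutations' _).nodup_iff.1
    (List.nodup_permutations _ (List.nodup_reverse.2 List.nodup_range))

lemma permList_injective (n : ℕ) : Function.Injective (permList n) := by
  intro v w h
  ext i
  exact congrFun (List.ofFn_injective h) i

lemma range_permList (n : ℕ) : Set.range (permList n) = {l | l ∈ arrangements n} := by
  ext l
  simp only [Set.mem_range, Set.mem_ofPred_eq, mem_arrangements]
  constructor
  · rintro ⟨w, rfl⟩
    refine (List.perm_ext_iff_of_nodup (nodup_permList n w) List.nodup_range).2 fun k => ?_
    simp only [permList, List.mem_ofFn, List.mem_range]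
    exact ⟨by rintro ⟨i, rfl⟩; exact (w i).2, fun hk => ⟨w.symm ⟨k, hk⟩, by simp⟩⟩
  · intro h
    have hlen : l.length = n := by simpa using h.length_eq
    have hnd : l.Nodup := h.nodup_iff.2 List.nodup_range
    subst hlen
    have hlt (i : Fin l.length) : l[i] < l.length := List.mem_range.1 (h.subset (l.getElem_mem i.2))
    have hinj : Function.Injective fun i : Fin l.length => (⟨l[i], hlt i⟩ : Fin l.length) := by
      intro i j hij
      exact hnd.injective_get (by simpa using hij)
    refine ⟨Equiv.ofBijective _ (Finite.injective_iff_bijective.1 hinj), ?_⟩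
    simp [permList]

/-- The number of arrangements of `0, …, n - 1` that have statistic `k`, as an integer. -/
def turnCount (n k : ℕ) : ℤ :=
  ((arrangements n).map fun l => if turns false 0 l = k then (1 : ℤ) else 0).sum

lemma sum_arrangements_succ (f : ℕ → ℤ) (n : ℕ) :
    ((arrangements (n + 1)).map fun l => f (turns false 0 l)).sum =
      ((arrangements n).map fun l => turns false 0 l * f (turns false 0 l) +
        f (turns false 0 l + 1) + (n - turns false 0 l) * f (turns false 0 l + 2)).sum := by
  rw [arrangements_succ, List.map_flatMap, List.flatMap, List.sum_flatten, List.map_map]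
  congr 1
  refine List.map_congr_left fun l hl => ?_
  rw [Function.comp_apply]
  have hp := mem_arrangements.1 hl
  rw [(sum_turns_insert f (fun b hb => List.mem_range.1 (hp.subset hb)) n.zero_le).1,
    hp.length_eq, List.length_range]

lemma turnCount_zero (n : ℕ) : turnCount (n + 1) 0 = 0 := by
  have h := sum_arrangements_succ (fun r => if r = 0 then 1 else 0) n
  rw [turnCount, h]
  refine List.sum_eq_zero fun x hx => ?_
  obtain ⟨l, -, rfl⟩ := List.mem_map.1 hx
  by_cases h : turns false 0 l = 0 <;> simp [h]

lemma turnCount_one (n : ℕ) : turnCount (n + 1) 1 = turnCount n 1 + turnCount n 0 := by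
  simp only [turnCount]
  rw [sum_arrangements_succ (fun r => if r = 1 then 1 else 0) n, ← List.sum_map_add]
  congr 1
  refine List.map_congr_left fun l _ => ?_
  generalize turns false 0 l = r
  by_cases h : r = 1 <;> simp [h]

lemma turnCount_add_two (n k : ℕ) :
    turnCount (n + 1) (k + 2) =
      (k + 2) * turnCount n (k + 2) + turnCount n (k + 1) + (n - k) * turnCount n k := by
  simp only [turnCount]
  rw [sum_arrangements_succ (fun r => if r = k + 2 then 1 else 0) n, ← List.sum_map_mul_left,
    ← List.sum_map_mul_left, ← List.sum_map_add, ← List.sum_map_add]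
  congr 1
  refine List.map_congr_left fun l _ => ?_
  generalize turns false 0 l = r
  by_cases h : r = k + 2
  · subst h; simp
  · by_cases h' : r = k
    · subst h'; simp
    · simp [h, h']

lemma turnCount_values (n : ℕ) :
    turnCount (n + 1) 1 = 1 ∧ turnCount (n + 1) 2 = 2 ^ n - 1 ∧
      4 * turnCount (n + 1) 3 = 3 * 3 ^ n - 2 * n + 1 - 4 * 2 ^ n ∧
      8 * turnCount (n + 1) 4 =
        4 * 4 ^ n - 4 * (n - 1) * 2 ^ n - 6 * 3 ^ n + 4 * n - 2 := by
  induction n with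
  | zero => decide
  | succ n ih =>
    obtain ⟨h1, h2, h3, h4⟩ := ih
    have e1 := turnCount_one (n + 1)
    have e2 := turnCount_add_two (n + 1) 0
    have e3 := turnCount_add_two (n + 1) 1
    have e4 := turnCount_add_two (n + 1) 2
    rw [turnCount_zero] at e1 e2
    norm_num [h1, h2] at e1 e2 e3 e4
    refine ⟨e1, by rw [e2]; ring, ?_, ?_⟩
    · push_cast
      linear_combination 4 * e3 + 3 * h3
    · push_cast
      linear_combination 8 * e4 + 4 * h4 + 2 * h3

lemma bCount_eq_sum (n k : ℕ) : (bCount n k : ℤ) = ∑ j ∈ Finset.range (k + 1), turnCount n j := by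
  have hcard : bCount n k =
      ((arrangements n).toFinset.filter fun l => turns false 0 l ≤ k).card := by
    rw [← Set.ncard_coe_finset, bCount]
    have himg : (((arrangements n).toFinset.filter fun l => turns false 0 l ≤ k : Finset _) :
        Set (List ℕ)) = permList n '' {w | asLen n w ≤ k} := by
      ext l
      have := Set.ext_iff.1 (range_permList n) l
      simp only [Set.mem_range, Set.mem_ofPred_eq] at this
      simp only [Finset.coe_filter, List.mem_toFinset, ← this, Set.mem_ofPred_eq, Set.mem_image,
        asLen_eq_turns]
      constructor
      · rintro ⟨⟨w, rfl⟩, h⟩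
        exact ⟨w, h, rfl⟩
      · rintro ⟨w, h, rfl⟩
        exact ⟨⟨w, rfl⟩, h⟩
    rw [himg, Set.ncard_image_of_injective _ (permList_injective n)]
    rfl
  have hsum (j : ℕ) : turnCount n j =
      ∑ l ∈ (arrangements n).toFinset, if turns false 0 l = j then (1 : ℤ) else 0 := by
    rw [turnCount, List.sum_toFinset _ (nodup_arrangements n)]
  simp only [hsum, hcard]
  rw [Finset.sum_comm, Finset.card_filter]
  push_cast
  refine Finset.sum_congr rfl fun l _ => ?_
  simp

theorem bCount_four (n : ℕ) (hn : 1 ≤ n) :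
    (8 * bCount n 4 : ℤ) = 4 ^ n - 2 * ((n : ℤ) - 2) * 2 ^ n := by
  obtain ⟨n, rfl⟩ := Nat.exists_eq_add_of_le' hn
  obtain ⟨h1, h2, h3, h4⟩ := turnCount_values n
  rw [bCount_eq_sum]
  simp only [Finset.sum_range_succ, Finset.sum_range_zero, turnCount_zero]
  push_cast
  linear_combination 8 * h1 + 8 * h2 + 2 * h3 + h4
end
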